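/- Let E be a symmetric monoidal category and let x, y be objects of E. If the object x ⊗ y is invertible in E, then both x and y are invertible in E. -/

import Mathlib

open CategoryTheory MonoidalCategory

/-- An object `x` of a monoidal category is invertible if there is an object `x'`
with `x ⊗ x' ≅ 𝟙_ C` and `x' ⊗ x ≅ 𝟙_ C`. -/
def IsInvertibleObj {E : Type*} [Category E] [MonoidalCategory E] (x : E) : Prop :=
  ∃ x' : E, Nonempty (x ⊗ x' ≅ 𝟙_ E) ∧ Nonempty (x' ⊗ x ≅ 𝟙_ E)

/-- In a braided category, a one-sided tensor inverse is two-sided. -/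
theorem IsInvertibleObj.of_tensor_iso_unit {E : Type*} [Category E] [MonoidalCategory E]
    [BraidedCategory E] {x x' : E} (e : x ⊗ x' ≅ 𝟙_ E) : IsInvertibleObj x :=
  ⟨x', ⟨e⟩, ⟨β_ x' x ≪≫ e⟩⟩

theorem invertible_factors_of_invertible_tensor
    {E : Type*} [Category E] [MonoidalCategory E] [SymmetricCategory E]
    (x y : E) (h : IsInvertibleObj (x ⊗ y)) :
    IsInvertibleObj x ∧ IsInvertibleObj y := by
  obtain ⟨z, ⟨e⟩, -⟩ := h
  exact ⟨.of_tensor_iso_unit ((α_ x y z).symm ≪≫ e),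
    .of_tensor_iso_unit ((α_ y x z).symm ≪≫ whiskerRightIso (β_ y x) z ≪≫ e)⟩
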